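/- Consider the Dickson nearfield setup. Let α, β ∈ F be such that α, β, α+β are all nonzero and all lie in the same coset g^{[k]_q}H for some 1 ≤ k ≤ n. Then the commutant {x ∈ F : x ∘ y = y ∘ x for all y ∈ D(α,β)} equals the distributive set D(R) = {λ ∈ F : (a+b) ∘ λ = a ∘ λ + b ∘ λ for all a, b ∈ F}. -/

import Mathlib

/-- `(q, n)` is a Dickson pair: `q` is a prime power, every prime divisor of `n`
divides `q - 1`, and if `q ≡ 3 (mod 4)` then `4` does not divide `n`. -/
def IsDicksonPair (q n : ℕ) : Prop :=
  0 < q ∧ 0 < n ∧ (∃ p l : ℕ, Nat.Prime p ∧ 0 < l ∧ q = p ^ l) ∧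
    (∀ p : ℕ, Nat.Prime p → p ∣ n → p ∣ q - 1) ∧ (q % 4 = 3 → ¬ 4 ∣ n)

/-- `[k]_q = 1 + q + q^2 + ⋯ + q^(k-1)`. -/
def dq (q k : ℕ) : ℕ := ∑ i ∈ Finset.range k, q ^ i

/-- `x` lies in the coset `g^([k]_q) • H` where `H = ⟨g^n⟩`. -/
def inCoset {F : Type*} [Field F] (g : F) (q n k : ℕ) (x : F) : Prop :=
  ∃ j : ℕ, x = g ^ dq q k * (g ^ n) ^ j

theorem dq_add (q k m : ℕ) : dq q (k + m) = dq q k + q ^ k * dq q m := by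
  unfold dq
  rw [Finset.sum_range_add, Finset.mul_sum]
  simp [pow_add]

theorem dq_mul_sub_one {q : ℕ} (hq : 0 < q) (k : ℕ) : dq q k * (q - 1) = q ^ k - 1 :=
  geom_sum_mul_of_one_le hq k

theorem dq_pos {q k : ℕ} (hk : 0 < k) : 0 < dq q k := by
  obtain ⟨m, rfl⟩ : ∃ m, k = 1 + m := ⟨k - 1, by lia⟩
  rw [dq_add]
  simp [dq]

/-- If `q` is odd then `[m]_q` and `m` have the same parity. -/
theorem even_of_even_dq {q : ℕ} (hq : Odd q) {m : ℕ} (h : Even (dq q m)) : Even m := by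
  simpa [dq, Finset.even_sum_iff_even_card_odd, hq.pow] using h

theorem IsDicksonPair.two_le {q n : ℕ} (h : IsDicksonPair q n) : 2 ≤ q := by
  obtain ⟨-, -, ⟨p, l, hp, hl, rfl⟩, -⟩ := h
  exact hp.two_le.trans (Nat.le_self_pow hl.ne' p)

theorem IsDicksonPair.three_le {q n : ℕ} (h : IsDicksonPair q n) (hn : n ≠ 1) : 3 ≤ q := by
  have h2 := h.two_le
  obtain ⟨p, hp, hpn⟩ := Nat.exists_prime_and_dvd hn
  have := Nat.le_of_dvd (by lia) (h.2.2.2.1 p hp hpn)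
  have := hp.two_le
  lia

theorem IsDicksonPair.not_prime_dvd {q n p : ℕ} (h : IsDicksonPair q n) (hp : p.Prime)
    (hpn : p ∣ n) : ¬ p ∣ q := fun hpq => by
  have h2 := h.two_le
  have h1 := Nat.dvd_sub hpq (h.2.2.2.1 p hp hpn)
  rw [show q - (q - 1) = 1 by lia] at h1
  exact hp.one_lt.ne' (Nat.dvd_one.mp h1)

theorem IsDicksonPair.coprime {q n : ℕ} (h : IsDicksonPair q n) : Nat.Coprime n q :=
  Nat.coprime_of_dvd fun _ hp hpn hpq => h.not_prime_dvd hp hpn hpq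

/-- For a Dickson pair, `n ∣ [m]_q` forces `n ∣ m`. -/
theorem IsDicksonPair.dvd_of_dvd_dq {q n : ℕ} (h : IsDicksonPair q n) {m : ℕ}
    (hm : n ∣ dq q m) : n ∣ m := by
  rcases Nat.eq_zero_or_pos m with rfl | hm0
  · exact dvd_zero n
  have h2 := h.two_le
  refine (Nat.dvd_iff_prime_pow_dvd_dvd m n).mpr fun p a hp hpa => ?_
  rcases Nat.eq_zero_or_pos a with rfl | ha
  · simp
  have : Fact p.Prime := ⟨hp⟩
  have hpn : p ∣ n := (dvd_pow_self p ha.ne').trans hpa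
  have hpq := h.2.2.2.1 p hp hpn
  have hnpq := h.not_prime_dvd hp hpn
  have hdq := dq_pos (q := q) hm0
  have hle := (padicValNat_dvd_iff_le hdq.ne').mp (hpa.trans hm)
  have hval : padicValNat p (q ^ m - 1) = padicValNat p (dq q m) + padicValNat p (q - 1) := by
    rw [← dq_mul_sub_one (by lia) m, padicValNat.mul hdq.ne' (by lia)]
  rcases hp.eq_two_or_odd' with rfl | hodd
  · have hqodd : Odd q := by
      rw [← Nat.not_even_iff_odd, even_iff_two_dvd]
      exact hnpq
    have hme : Even m := even_of_even_dq hqodd (even_iff_two_dvd.mpr (hpn.trans hm))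
    by_cases hq4 : q % 4 = 3
    · have ha1 : a < 2 := by
        by_contra hcon
        exact h.2.2.2.2 hq4 ((pow_dvd_pow 2 (by lia : 2 ≤ a)).trans hpa)
      obtain rfl : a = 1 := by lia
      simpa using even_iff_two_dvd.mp hme
    · have hlte := padicValNat.pow_two_sub_pow (x := q) (y := 1) (by lia) hpq hnpq hm0.ne' hme
      have hq1 : padicValNat 2 (q + 1) < 2 := by
        by_contra hcon
        have := (padicValNat_dvd_iff_le (p := 2) (n := 2) (a := q + 1) (by lia)).mpr (by lia)
        lia
      rw [one_pow] at hlte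
      exact (padicValNat_dvd_iff_le hm0.ne').mpr (by lia)
  · have hlte := padicValNat.pow_sub_pow (x := q) (y := 1) hodd (by lia) hpq hnpq hm0.ne'
    rw [one_pow] at hlte
    exact (padicValNat_dvd_iff_le hm0.ne').mpr (by lia)

theorem IsDicksonPair.dvd_sub_of_modEq {q n : ℕ} (h : IsDicksonPair q n) {k l : ℕ} (hkl : k ≤ l)
    (hmod : dq q k ≡ dq q l [MOD n]) : n ∣ l - k := by
  obtain ⟨m, rfl⟩ := Nat.exists_eq_add_of_le hkl
  rw [dq_add] at hmod
  have h1 : n ∣ q ^ k * dq q m := by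
    simpa using (Nat.modEq_iff_dvd' (Nat.le_add_right _ _)).mp hmod
  have := h.dvd_of_dvd_dq ((h.coprime.pow_right k).dvd_of_dvd_mul_left h1)
  simpa using this

/-- The numbers `[1]_q, …, [n]_q` represent all residue classes modulo `n`. -/
theorem IsDicksonPair.exists_dq_modEq {q n : ℕ} (h : IsDicksonPair q n) (j : ℕ) :
    ∃ k, 1 ≤ k ∧ k ≤ n ∧ dq q k ≡ j [MOD n] := by
  have : NeZero n := ⟨h.2.1.ne'⟩
  have hinj : Function.Injective fun i : Fin n => (dq q (i + 1) : ZMod n) := by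
    have key : ∀ a b : Fin n, a ≤ b → (dq q (a + 1) : ZMod n) = dq q (b + 1) → a = b := by
      intro a b hab heq
      have hd := h.dvd_sub_of_modEq (k := a + 1) (l := b + 1) (by simpa using hab)
        ((ZMod.natCast_eq_natCast_iff _ _ _).mp heq)
      have hb := b.2
      have := Nat.eq_zero_of_dvd_of_lt hd (by lia)
      ext
      have : (a : ℕ) ≤ b := hab
      lia
    intro a b heq
    rcases le_total a b with hab | hab
    · exact key a b hab heq
    · exact (key b a hab heq.symm).symm
  have hbij := (Fintype.bijective_iff_injective_and_card _).mpr ⟨hinj, by simp [ZMod.card]⟩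
  obtain ⟨i, hi⟩ := hbij.2 (j : ZMod n)
  exact ⟨i + 1, by lia, i.2, (ZMod.natCast_eq_natCast_iff _ _ _).mp hi⟩

theorem IsDicksonPair.dvd_dq_self {q n : ℕ} (h : IsDicksonPair q n) : n ∣ dq q n := by
  obtain ⟨k, hk1, hkn, hk⟩ := h.exists_dq_modEq 0
  have h1 : n ∣ dq q k := (Nat.modEq_zero_iff_dvd).mp hk
  obtain rfl : k = n := le_antisymm hkn (Nat.le_of_dvd hk1 (h.dvd_of_dvd_dq h1))
  exact h1

theorem IsDicksonPair.dvd_pow_sub_one {q n : ℕ} (h : IsDicksonPair q n) : n ∣ q ^ n - 1 :=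
  dq_mul_sub_one h.1 n ▸ Dvd.dvd.mul_right h.dvd_dq_self _

theorem two_mul_lt_three_pow (e : ℕ) : 2 * e < 3 ^ e := by
  induction e with
  | zero => simp
  | succ e ih => rw [pow_succ]; lia

theorem sq_add_two_le_three_pow {n : ℕ} (hn : 1 ≤ n) : n ^ 2 + 2 ≤ 3 ^ n := by
  induction n, hn using Nat.le_induction with
  | base => simp
  | succ n hn ih => rw [pow_succ 3]; nlinarith

theorem IsDicksonPair.eq_of_pow_sub_one_dvd {q n k : ℕ} (h : IsDicksonPair q n) (hk1 : 1 ≤ k)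
    (hkn : k ≤ n) (hd : q ^ n - 1 ∣ n * (q ^ k - 1)) : k = n := by
  by_contra hne
  have hq := h.three_le (by lia)
  have h1 : q ^ n - 1 ∣ n * (q ^ n.gcd k - 1) := by
    rw [← Nat.pow_sub_one_gcd_pow_sub_one, ← Nat.gcd_mul_left]
    exact Nat.dvd_gcd (Dvd.intro_left n rfl) hd
  have hdk : n.gcd k ≤ k := Nat.gcd_le_right n hk1
  have hdpos : 0 < n.gcd k := Nat.gcd_pos_of_pos_right n hk1
  obtain ⟨c, hc⟩ := Nat.gcd_dvd_left n k
  generalize n.gcd k = d at *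
  have hc2 : 2 ≤ c := by
    by_contra hcon
    have := Nat.mul_le_mul_left d (by lia : c ≤ 1)
    lia
  have hnd : n ≤ 2 * (n - d) := by
    have : d * 2 ≤ n := hc ▸ Nat.mul_le_mul_left d hc2
    lia
  have hqd : 1 < q ^ d := Nat.one_lt_pow hdpos.ne' (by lia)
  have hle := Nat.le_of_dvd (Nat.mul_pos h.2.1 (by lia)) h1
  have h3 : n < q ^ (n - d) :=
    (hnd.trans_lt (two_mul_lt_three_pow _)).trans_le (Nat.pow_le_pow_left hq _)
  have hsplit : q ^ n = q ^ (n - d) * q ^ d := by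
    rw [← pow_add]
    congr 1
    lia
  obtain ⟨t, ht⟩ := Nat.exists_eq_add_of_lt hqd
  rw [hsplit, ht] at hle
  have h4 := Nat.mul_le_mul_right (1 + t + 1) (Nat.succ_le_of_lt h3)
  simp only [Nat.succ_eq_add_one, Nat.add_sub_cancel] at h4 hle
  have h5 : n * (1 + t) < (n + 1) * (1 + t + 1) - 1 := by
    have : (n + 1) * (1 + t + 1) = n * (1 + t) + n + t + 2 := by ring
    lia
  lia

theorem pow_mul_sub_one_eq_one {F : Type*} [Field F] {g : F} (hg0 : g ≠ 0) {m Q : ℕ} (hQ : 1 ≤ Q)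
    (h : (g ^ m) ^ Q = g ^ m) : g ^ (m * (Q - 1)) = 1 := by
  rw [← pow_mul, ← Nat.sub_add_cancel hQ, mul_add, mul_one, pow_add] at h
  exact mul_right_cancel₀ (pow_ne_zero m hg0) (h.trans (one_mul _).symm)

section Coset

variable {F : Type*} [Field F] [Fintype F] {q n : ℕ} {g : F}

theorem orderOf_of_forall_eq_pow (hg0 : g ≠ 0) (hg : ∀ x : F, x ≠ 0 → ∃ j : ℕ, x = g ^ j) :
    orderOf g = Fintype.card F - 1 := by
  classical
  have h1 := orderOf_eq_card_of_forall_mem_zpowers (g := Units.mk0 g hg0) fun x => by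
    obtain ⟨j, hj⟩ := hg x x.ne_zero
    exact ⟨j, by ext; simp [hj]⟩
  rw [Nat.card_eq_fintype_card, Fintype.card_units, ← orderOf_units] at h1
  simpa using h1

theorem IsDicksonPair.inCoset_pow (h : IsDicksonPair q n) (hcard : Fintype.card F = q ^ n)
    (hg0 : g ≠ 0) {k j : ℕ} (hk : dq q k ≡ j [MOD n]) : inCoset g q n k (g ^ j) := by
  have hQ : 1 < q ^ n := Nat.one_lt_pow h.2.1.ne' h.two_le
  have hone : g ^ (q ^ n - 1) = 1 := hcard ▸ FiniteField.pow_card_sub_one_eq_one g hg0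
  have hle : dq q k ≤ j + (q ^ n - 1) * dq q k :=
    (Nat.le_mul_of_pos_left _ (by lia)).trans (Nat.le_add_left _ _)
  have hmod : dq q k ≡ j + (q ^ n - 1) * dq q k [MOD n] := by
    have h0 : (q ^ n - 1) * dq q k ≡ 0 [MOD n] :=
      Nat.modEq_zero_iff_dvd.mpr (h.dvd_pow_sub_one.mul_right _)
    simpa using hk.add h0.symm
  obtain ⟨i, hi⟩ := (Nat.modEq_iff_dvd' hle).mp hmod
  refine ⟨i, ?_⟩
  rw [← pow_mul, ← pow_add, ← hi, Nat.add_sub_of_le hle, pow_add, pow_mul, hone]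
  simp

theorem IsDicksonPair.exists_inCoset (h : IsDicksonPair q n) (hcard : Fintype.card F = q ^ n)
    (hg0 : g ≠ 0) (hg : ∀ x : F, x ≠ 0 → ∃ j : ℕ, x = g ^ j) {x : F} (hx : x ≠ 0) :
    ∃ k, 1 ≤ k ∧ k ≤ n ∧ inCoset g q n k x := by
  obtain ⟨j, rfl⟩ := hg x hx
  obtain ⟨k, hk1, hkn, hk⟩ := h.exists_dq_modEq j
  exact ⟨k, hk1, hkn, h.inCoset_pow hcard hg0 hk⟩

/-- If `T` is additive, acts as multiplication by `c` on `⟨g ^ n⟩` and as multiplication by `d`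
on `g⟨g ^ n⟩`, then `c = d`. -/
theorem IsDicksonPair.eq_of_additive (h : IsDicksonPair q n) (hn : n ≠ 1)
    (hcard : Fintype.card F = q ^ n) (hord : orderOf g = q ^ n - 1) (hg0 : g ≠ 0) {T : F → F}
    (hT : ∀ a b, T (a + b) = T a + T b) {c d : F}
    (hc : ∀ i : ℕ, T (g ^ (n * i)) = g ^ (n * i) * c)
    (hd : ∀ i : ℕ, T (g ^ (1 + n * i)) = g ^ (1 + n * i) * d) : c = d := by
  by_contra hcd
  obtain ⟨s, hs⟩ := h.dvd_pow_sub_one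
  have hn0 := h.2.1
  have hpow : ∀ i j : Fin s, g ^ (n * (i : ℕ)) = g ^ (n * (j : ℕ)) → i = j := by
    intro i j hij
    have hlt : ∀ i : Fin s, n * (i : ℕ) ∈ Set.Iio (orderOf g) := fun i => by
      rw [Set.mem_Iio, hord, hs]
      exact Nat.mul_lt_mul_of_pos_left i.2 hn0
    have := pow_injOn_Iio_orderOf (hlt i) (hlt j) hij
    exact Fin.ext (Nat.eq_of_mul_eq_mul_left hn0 this)
  have hinj : Function.Injective fun ij : Fin s × Fin s =>
      g ^ (n * (ij.1 : ℕ)) + g ^ (1 + n * (ij.2 : ℕ)) := by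
    rintro ⟨i, j⟩ ⟨i', j'⟩ heq
    simp only at heq
    have hTeq := congrArg T heq
    rw [hT, hT, hc, hd, hc, hd] at hTeq
    have h0 : (c - d) * (g ^ (n * (i : ℕ)) - g ^ (n * (i' : ℕ))) = 0 := by
      linear_combination hTeq - d * heq
    have hi : g ^ (n * (i : ℕ)) = g ^ (n * (i' : ℕ)) :=
      sub_eq_zero.mp ((mul_eq_zero.mp h0).resolve_left (sub_ne_zero.mpr hcd))
    have hj : g ^ (n * (j : ℕ)) = g ^ (n * (j' : ℕ)) := by
      rw [hi, add_right_inj, pow_add, pow_add] at heq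
      exact mul_left_cancel₀ (pow_ne_zero 1 hg0) heq
    rw [hpow i i' hi, hpow j j' hj]
  have hle := Fintype.card_le_of_injective _ hinj
  rw [Fintype.card_prod, Fintype.card_fin, hcard] at hle
  have hbig : n ^ 2 + 2 ≤ q ^ n :=
    (sq_add_two_le_three_pow hn0).trans (Nat.pow_le_pow_left (h.three_le hn) n)
  have hsn : n < s := by
    by_contra hcon
    have := Nat.mul_le_mul_left n (not_lt.mp hcon)
    rw [← pow_two] at this
    lia
  have := Nat.mul_le_mul_right s (Nat.succ_le_of_lt hsn)
  rw [Nat.succ_mul] at this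
  lia

end Coset

/-- Dickson nearfield setup: if `α`, `β`, `α+β` are nonzero and all lie in the same
coset `g^([k]_q) H`, then the commutant of `D(α,β)` (with respect to `∘`) equals the
set `D(R)` of distributive elements of the nearfield. -/
theorem commutant_of_distributiveSet_eq_DR {F : Type*} [Field F] [Fintype F]
    (q n : ℕ) (hqn : IsDicksonPair q n)
    (hcard : Fintype.card F = q ^ n)
    (g : F) (hg : ∀ x : F, x ≠ 0 → ∃ j : ℕ, x = g ^ j)
    (circ : F → F → F)
    (hcirc0 : ∀ lam : F, circ 0 lam = 0)
    (hcirc : ∀ k : ℕ, 1 ≤ k → k ≤ n → ∀ x : F, inCoset g q n k x →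
      ∀ lam : F, circ x lam = x * lam ^ q ^ k)
    (α β : F) (hα : α ≠ 0) (hβ : β ≠ 0) (hαβ : α + β ≠ 0)
    (k : ℕ) (hk1 : 1 ≤ k) (hkn : k ≤ n)
    (hcα : inCoset g q n k α) (hcβ : inCoset g q n k β)
    (hcαβ : inCoset g q n k (α + β)) :
    {x : F | ∀ y ∈ {lam : F | circ (α + β) lam = circ α lam + circ β lam},
        circ x y = circ y x} =
      {lam : F | ∀ a b : F, circ (a + b) lam = circ a lam + circ b lam} := by
  have hq2 := hqn.two_le
  have hn0 := hqn.2.1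
  have hg0 : g ≠ 0 := by
    rintro rfl
    obtain ⟨j, hj⟩ := hcα
    exact hα (by rw [hj, zero_pow (dq_pos hk1).ne', zero_mul])
  have hord : orderOf g = q ^ n - 1 := hcard ▸ orderOf_of_forall_eq_pow hg0 hg
  have hpown : ∀ y : F, y ^ q ^ n = y := fun y => hcard ▸ FiniteField.pow_card y
  have hH : ∀ i : ℕ, ∀ lam : F, circ (g ^ (n * i)) lam = g ^ (n * i) * lam := by
    intro i lam
    have hmod : dq q n ≡ n * i [MOD n] :=
      (Nat.modEq_zero_iff_dvd.mpr hqn.dvd_dq_self).trans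
        (Nat.modEq_zero_iff_dvd.mpr (Dvd.intro i rfl)).symm
    rw [hcirc n hn0 le_rfl _ (hqn.inCoset_pow hcard hg0 hmod), hpown]
  have hgH : ∀ i : ℕ, ∀ lam : F, circ (g ^ (1 + n * i)) lam = g ^ (1 + n * i) * lam ^ q := by
    intro i lam
    have hmod : dq q 1 ≡ 1 + n * i [MOD n] := by simp [dq, Nat.ModEq]
    rw [hcirc 1 le_rfl hn0 _ (hqn.inCoset_pow hcard hg0 hmod), pow_one]
  have hfix : ∀ lam : F, lam ^ q = lam → ∀ a, circ a lam = a * lam := by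
    intro lam hlam a
    rcases eq_or_ne a 0 with rfl | ha
    · rw [hcirc0, zero_mul]
    obtain ⟨l, hl1, hln, hl⟩ := hqn.exists_inCoset hcard hg0 hg ha
    have hiter : ∀ m : ℕ, lam ^ q ^ m = lam := by
      intro m
      induction m with
      | zero => simp
      | succ m ih => rw [pow_succ, pow_mul, ih, hlam]
    rw [hcirc l hl1 hln a hl, hiter]
  have hR : ∀ lam : F, (∀ a b : F, circ (a + b) lam = circ a lam + circ b lam) ↔
      lam ^ q = lam := by
    intro lam
    refine ⟨fun hlam => ?_, fun hlam a b => by simp only [hfix lam hlam, add_mul]⟩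
    rcases eq_or_ne n 1 with rfl | hn1
    · simpa using hpown lam
    · exact (hqn.eq_of_additive hn1 hcard hord hg0 (T := fun a => circ a lam) hlam
        (fun i => hH i lam) (fun i => hgH i lam)).symm
  have hC : ∀ x : F, (∀ y : F, circ x y = circ y x) ↔ x ^ q = x := by
    intro x
    rcases eq_or_ne x 0 with rfl | hx
    · have h0 : (0 : F) ^ q = 0 := zero_pow (by lia)
      simp [h0, hcirc0, hfix 0 h0]
    constructor
    · intro hcomm
      obtain ⟨l, hl1, hln, hl⟩ := hqn.exists_inCoset hcard hg0 hg hx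
      have h1 := hcomm (g ^ (n * 1))
      rw [hH, hcirc l hl1 hln x hl, mul_comm, mul_one] at h1
      have h2 := mul_right_cancel₀ hx h1
      have h3 := pow_mul_sub_one_eq_one hg0 (pow_pos hqn.1 l) h2
      rw [← orderOf_dvd_iff_pow_eq_one, hord] at h3
      obtain rfl := hqn.eq_of_pow_sub_one_dvd hl1 hln h3
      have h4 := hcomm (g ^ (1 + l * 0))
      rw [hgH, hcirc l hl1 hln x hl, hpown, mul_comm] at h4
      exact (mul_left_cancel₀ (pow_ne_zero _ hg0) h4).symm
    · intro hxq y
      rw [hfix x hxq]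
      obtain ⟨j, rfl⟩ := hg x hx
      have hdvd : n ∣ j := by
        have h1 := pow_mul_sub_one_eq_one hg0 hqn.1 hxq
        rw [← orderOf_dvd_iff_pow_eq_one, hord, ← dq_mul_sub_one hqn.1] at h1
        exact hqn.dvd_dq_self.trans (Nat.dvd_of_mul_dvd_mul_right (by lia) h1)
      obtain ⟨i, rfl⟩ := hdvd
      rw [hH, mul_comm]
  have hD : ∀ y : F, circ (α + β) y = circ α y + circ β y := by
    intro y
    rw [hcirc k hk1 hkn _ hcα, hcirc k hk1 hkn _ hcβ, hcirc k hk1 hkn _ hcαβ, add_mul]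
  ext x
  simp only [Set.mem_ofPred_eq, hD, forall_const, hC, hR]
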